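/- arXiv:2112.12451 — 2 statements merged into one kernel-verified Lean document; each statement's English description precedes it below -/
import Mathlib

section
/- Let X be a compact metric space, T : X → X continuous, and Λ a nonempty compact subset of M(X,T) such that the ergodic measures in Λ are dense in Λ. If F is a dense subset of C(X, GL_d(ℝ)), then ∪_{A∈F} M^Λ_max(A) is dense in Λ (in the weak-* topology). -/
open MeasureTheory Topology Filter Set

noncomputable section

/-- Operator space of d×d real matrices, realized as continuous linear endomorphisms
of Euclidean space with the operator norm. -/
abbrev Md (d : ℕ) := EuclideanSpace ℝ (Fin d) →L[ℝ] EuclideanSpace ℝ (Fin d)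

/-- The space `C(X, GL_d(ℝ))` of continuous `GL_d(ℝ)`-valued maps, encoded as pairs
`(A, A⁻¹)` of continuous matrix-valued maps that are pointwise mutually inverse.
The metric (inherited from the product of sup metrics) induces the same topology as
`ρ(A,B) = max_x (‖A x - B x‖ + ‖A x⁻¹ - B x⁻¹‖)`. -/
def GLC (X : Type*) [TopologicalSpace X] (d : ℕ) : Type _ :=
  {p : C(X, Md d) × C(X, Md d) // ∀ x, p.1 x * p.2 x = 1 ∧ p.2 x * p.1 x = 1}

instance (X : Type*) [TopologicalSpace X] [CompactSpace X] (d : ℕ) :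
    MetricSpace (GLC X d) := by
  delta GLC; infer_instance

/-- The metric ρ of the paper. -/
def rho {X : Type*} [TopologicalSpace X] [CompactSpace X] {d : ℕ} (A B : GLC X d) : ℝ :=
  ⨆ x : X, (‖A.1.1 x - B.1.1 x‖ + ‖A.1.2 x - B.1.2 x‖)

/-- The cocycle `A(n,x) = A(T^{n-1} x) ⋯ A(x)`. -/
def coc {X : Type*} [TopologicalSpace X] {d : ℕ} (T : X → X) (A : GLC X d) :
    ℕ → X → Md d
  | 0, _ => 1
  | n + 1, x => coc T A n (T x) * A.1.1 x

/-- The average `(1/n) ∫ log ‖A(n,x)‖ dμ`. -/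
def lyapAvg {X : Type*} [TopologicalSpace X] [MeasurableSpace X] {d : ℕ}
    (T : X → X) (A : GLC X d) (μ : ProbabilityMeasure X) (n : ℕ) : ℝ :=
  (n : ℝ)⁻¹ * ∫ x, Real.log ‖coc T A n x‖ ∂(μ : Measure X)

/-- `inf_{n ≥ 1} (1/n) ∫ log ‖A(n,x)‖ dμ`. -/
def lyapExp {X : Type*} [TopologicalSpace X] [MeasurableSpace X] {d : ℕ}
    (T : X → X) (A : GLC X d) (μ : ProbabilityMeasure X) : ℝ :=
  ⨅ n : {n : ℕ // 1 ≤ n}, lyapAvg T A μ n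

/-- `β^Λ(A)`, the maximum ergodic average over Λ. -/
def betaL {X : Type*} [TopologicalSpace X] [MeasurableSpace X] {d : ℕ}
    (T : X → X) (Λ : Set (ProbabilityMeasure X)) (A : GLC X d) : ℝ :=
  ⨆ μ : Λ, lyapExp T A μ

/-- `M^Λ_max(A)`, the set of maximizing measures over Λ. -/
def MmaxL {X : Type*} [TopologicalSpace X] [MeasurableSpace X] {d : ℕ}
    (T : X → X) (Λ : Set (ProbabilityMeasure X)) (A : GLC X d) :
    Set (ProbabilityMeasure X) :=
  {μ | μ ∈ Λ ∧ lyapExp T A μ = betaL T Λ A}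

/-- The set of T-invariant Borel probability measures `M(X,T)`. -/
def invM {X : Type*} [TopologicalSpace X] [MeasurableSpace X]
    (T : X → X) : Set (ProbabilityMeasure X) :=
  {μ | (μ : Measure X).map T = (μ : Measure X)}

set_option synthInstance.maxHeartbeats 1000000 in
/-- The scaled cocycle `x ↦ e^{g x} A(x)`. -/
def scale {X : Type*} [TopologicalSpace X] {d : ℕ} (g : C(X, ℝ)) (A : GLC X d) :
    GLC X d :=
  ⟨(⟨fun x => Real.exp (g x) • A.1.1 x, by fun_prop⟩,
    ⟨fun x => Real.exp (-(g x)) • A.1.2 x, by fun_prop⟩), by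
    intro x
    obtain ⟨h1, h2⟩ := A.2 x
    constructor <;>
      · dsimp only [ContinuousMap.coe_mk]
        ext v
        have hv1 := congrFun (congrArg DFunLike.coe h1) v
        have hv2 := congrFun (congrArg DFunLike.coe h2) v
        simp only [ContinuousLinearMap.mul_apply, ContinuousLinearMap.one_apply]
          at hv1 hv2 ⊢
        simp only [ContinuousLinearMap.smul_apply, _root_.map_smul, smul_smul]
        simp [hv1, hv2, ← mul_assoc, ← Real.exp_add]⟩

/-- The identity cocycle `x ↦ I_d`. -/
def idC (X : Type*) [TopologicalSpace X] (d : ℕ) : GLC X d :=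
  ⟨(ContinuousMap.const X 1, ContinuousMap.const X 1), fun _ => by simp⟩

/-- The set of Lyapunov-irregular points of A. -/
def LI {X : Type*} [TopologicalSpace X] {d : ℕ} (T : X → X) (A : GLC X d) : Set X :=
  {x | ¬ ∃ c : ℝ, Tendsto (fun n : ℕ => (n : ℝ)⁻¹ * Real.log ‖coc T A n x‖)
    atTop (𝓝 c)}



section helpers

variable {X : Type*} [MetricSpace X] [CompactSpace X] [MeasurableSpace X] [BorelSpace X]

/-- Birkhoff averages of a continuous function as a continuous function. -/
def bav (Tc : C(X, X)) (f : C(X, ℝ)) (N : ℕ) : C(X, ℝ) :=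
  (N : ℝ)⁻¹ • ∑ n ∈ Finset.range N, (fun g : C(X, ℝ) => g.comp Tc)^[n] f

lemma cint (f : C(X, ℝ)) (ν : Measure X) [IsFiniteMeasure ν] : Integrable f ν :=
  f.continuous.integrable_of_hasCompactSupport (HasCompactSupport.of_compactSpace _)

lemma int_iter (Tc : C(X, X)) (ν : Measure X) [IsProbabilityMeasure ν]
    (h : MeasurePreserving Tc ν ν) (f : C(X, ℝ)) (n : ℕ) :
    ∫ x, ((fun g : C(X, ℝ) => g.comp Tc)^[n] f) x ∂ν = ∫ x, f x ∂ν := by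
  induction n generalizing f with
  | zero => rfl
  | succ n ih =>
    rw [Function.iterate_succ_apply, ih]
    have := integral_map (μ := ν) h.measurable.aemeasurable
      (f := f) (by rw [h.map_eq]; exact f.continuous.aestronglyMeasurable)
    rw [h.map_eq] at this
    exact this.symm

lemma int_bav (Tc : C(X, X)) (ν : Measure X) [IsProbabilityMeasure ν]
    (h : MeasurePreserving Tc ν ν) (f : C(X, ℝ)) {N : ℕ} (hN : N ≠ 0) :
    ∫ x, bav Tc f N x ∂ν = ∫ x, f x ∂ν := by
  simp only [bav, ContinuousMap.smul_apply, ContinuousMap.sum_apply, smul_eq_mul]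
  rw [integral_const_mul, integral_finsetSum _ (fun i _ => cint _ ν)]
  simp only [int_iter Tc ν h, Finset.sum_const, Finset.card_range, nsmul_eq_mul]
  field_simp

lemma variance_eq (g : C(X, ℝ)) (ν : Measure X) [IsProbabilityMeasure ν] (c : ℝ) :
    ∫ x, (g x - c) ^ 2 ∂ν
      = ∫ x, (g x - ∫ y, g y ∂ν) ^ 2 ∂ν + ((∫ y, g y ∂ν) - c) ^ 2 := by
  have key : ∀ c : ℝ, ∫ x, (g x - c) ^ 2 ∂ν
      = ∫ x, (g x) ^ 2 ∂ν - 2 * c * ∫ x, g x ∂ν + c ^ 2 := by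
    intro c
    have h1 : ∀ x, (g x - c) ^ 2 = (g ^ 2 : C(X, ℝ)) x - (2 * c) * g x + c ^ 2 := by
      intro x; simp; ring
    simp_rw [h1]
    rw [integral_add, integral_sub, integral_const_mul]
    · simp
    · exact cint _ ν
    · exact (cint g ν).const_mul _
    · exact (cint _ ν).sub ((cint g ν).const_mul _)
    · exact integrable_const _
  rw [key, key]; ring

lemma mean_erg (Tc : C(X, X)) (μ : Measure X) [IsProbabilityMeasure μ]
    (h : Ergodic Tc μ) (f : C(X, ℝ)) {δ : ℝ} (hδ : 0 < δ) :
    ∃ N : ℕ, N ≠ 0 ∧ ∫ x, (bav Tc f N x - ∫ y, f y ∂μ) ^ 2 ∂μ < δ := by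
  have hmp := h.toMeasurePreserving
  set U : Lp ℝ 2 μ →L[ℝ] Lp ℝ 2 μ :=
    (Lp.compMeasurePreservingₗᵢ ℝ Tc hmp).toContinuousLinearMap with hU
  have hUn : ‖U‖ ≤ 1 := LinearIsometry.norm_toContinuousLinearMap_le _
  set L : C(X, ℝ) →L[ℝ] Lp ℝ 2 μ := ContinuousMap.toLp 2 μ ℝ with hL
  have hUL : ∀ g : C(X, ℝ), U (L g) = L (g.comp Tc) := fun g => rfl
  have hit : ∀ n (g : C(X, ℝ)), U^[n] (L g) = L ((fun g : C(X, ℝ) => g.comp Tc)^[n] g) := by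
    intro n
    induction n with
    | zero => intro g; rfl
    | succ n ih => intro g; rw [Function.iterate_succ_apply, hUL, ih]; rfl
  have hb : ∀ N, birkhoffAverage ℝ U _root_.id N (L f) = L (bav Tc f N) := by
    intro N
    simp [birkhoffAverage, birkhoffSum, bav, hit]
  have ht := U.tendsto_birkhoffAverage_orthogonalProjection hUn (L f)
  simp_rw [hb] at ht
  set P := (U.eqLocus (1 : Lp ℝ 2 μ →L[ℝ] Lp ℝ 2 μ)).orthogonalProjectionOnto (L f) with hP
  have hPinv : U (P : Lp ℝ 2 μ) = (P : Lp ℝ 2 μ) := P.2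
  obtain ⟨c, hc⟩ := h.ae_eq_const_of_ae_eq_comp_ae (g := ((P : Lp ℝ 2 μ) : X → ℝ))
    (Lp.aestronglyMeasurable _) (by
      have := Lp.coeFn_compMeasurePreserving (P : Lp ℝ 2 μ) hmp
      refine this.symm.trans ?_
      have h2 : Lp.compMeasurePreserving Tc hmp (P : Lp ℝ 2 μ) = (P : Lp ℝ 2 μ) := hPinv
      rw [h2])
  have hPc : (P : Lp ℝ 2 μ) = L (ContinuousMap.const X c) := by
    apply Lp.ext
    refine hc.trans ?_
    exact (ContinuousMap.coeFn_toLp μ (ContinuousMap.const X c)).symm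
  rw [hPc] at ht
  have hn : ∀ g : C(X, ℝ), ‖L g‖ ^ 2 = ∫ x, (g x) ^ 2 ∂μ := by
    intro g
    rw [← real_inner_self_eq_norm_sq, L2.inner_def]
    apply integral_congr_ae
    filter_upwards [ContinuousMap.coeFn_toLp (p := 2) (𝕜 := ℝ) μ g] with x hx
    rw [hL, hx]; simp [sq]
  have h3 : Tendsto (fun N => ‖L (bav Tc f N) - L (ContinuousMap.const X c)‖ ^ 2) atTop (𝓝 0) := by
    have := (tendsto_iff_norm_sub_tendsto_zero.1 ht).pow 2
    simpa using this
  obtain ⟨N, hN1, hN2⟩ := ((h3.eventually (gt_mem_nhds hδ)).and (eventually_ne_atTop 0)).exists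
  refine ⟨N, hN2, ?_⟩
  rw [← map_sub, hn] at hN1
  have h4 := variance_eq (bav Tc f N) μ c
  rw [int_bav Tc μ hmp f hN2] at h4
  have h5 : ∫ x, ((bav Tc f N - ContinuousMap.const X c) x) ^ 2 ∂μ
    = ∫ x, (bav Tc f N x - c) ^ 2 ∂μ := rfl
  nlinarith [sq_nonneg ((∫ y, f y ∂μ) - c)]

/-- the filter of sets that can be separated -/
def sepFilter (T : X → X) (μ : ProbabilityMeasure X) : Filter (ProbabilityMeasure X) where
  sets := {S | ∀ δ > 0, ∃ φ : C(X, ℝ), (∀ x, φ x ≤ 0) ∧ -δ ≤ ∫ x, φ x ∂(μ : Measure X) ∧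
    ∀ ν ∈ invM T, ν ∉ S → ∫ x, φ x ∂(ν : Measure X) ≤ -1}
  univ_sets := fun δ hδ => ⟨0, by simp, by simp [hδ.le], by simp⟩
  sets_of_superset := by
    intro S S' hS hSS δ hδ
    obtain ⟨φ, h1, h2, h3⟩ := hS δ hδ
    exact ⟨φ, h1, h2, fun ν hν hn => h3 ν hν (fun h => hn (hSS h))⟩
  inter_sets := by
    intro S S' hS hS' δ hδ
    obtain ⟨φ, h1, h2, h3⟩ := hS (δ / 2) (by linarith)
    obtain ⟨φ', h1', h2', h3'⟩ := hS' (δ / 2) (by linarith)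
    refine ⟨φ + φ', fun x => by have := h1 x; have := h1' x; simp; linarith, ?_, ?_⟩
    · simp only [ContinuousMap.add_apply]
      rw [integral_add (cint _ _) (cint _ _)]; linarith
    · intro ν hν hn
      simp only [ContinuousMap.add_apply]
      rw [integral_add (cint _ _) (cint _ _)]
      have a : ∫ x, φ x ∂(ν : Measure X) ≤ 0 := integral_nonpos h1
      have a' : ∫ x, φ' x ∂(ν : Measure X) ≤ 0 := integral_nonpos h1'
      by_cases hs : ν ∈ S
      · have := h3' ν hν (fun h => hn ⟨hs, h⟩)
        linarith
      · have := h3 ν hν hs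
        linarith

lemma sep_le (T : X → X) (hT : Continuous T) (μ : ProbabilityMeasure X)
    (h : Ergodic T (μ : Measure X)) : sepFilter T μ ≤ 𝓝 μ := by
  have : Tendsto (fun ν : ProbabilityMeasure X => ν) (sepFilter T μ) (𝓝 μ) := by
    rw [ProbabilityMeasure.tendsto_iff_forall_integral_tendsto]
    intro f
    rw [Metric.tendsto_nhds]
    intro ε hε δ hδ
    set fc : C(X, ℝ) := f.toContinuousMap
    obtain ⟨N, hN, hlt⟩ := mean_erg ⟨T, hT⟩ (μ : Measure X) h fc (mul_pos hδ (pow_pos hε 2))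
    set c := ∫ y, fc y ∂(μ : Measure X) with hc
    set g := bav ⟨T, hT⟩ fc N
    set φ : C(X, ℝ) := -((ε ^ 2)⁻¹) • (g - ContinuousMap.const X c) ^ 2 with hφ
    have hφx : ∀ x, φ x = -((ε ^ 2)⁻¹) * (g x - c) ^ 2 := fun x => by simp [hφ]
    have hε2 : 0 < ε ^ 2 := by positivity
    refine ⟨φ, ?_, ?_, ?_⟩
    · intro x; rw [hφx]
      have : 0 ≤ (ε ^ 2)⁻¹ * (g x - c) ^ 2 := by positivity
      linarith
    · simp_rw [hφx]
      rw [integral_const_mul, neg_mul]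
      apply neg_le_neg
      rw [inv_mul_le_iff₀ hε2]; linarith
    · intro ν hν hn
      simp_rw [hφx]
      rw [integral_const_mul, neg_mul]
      apply neg_le_neg
      rw [le_inv_mul_iff₀ hε2, mul_one]
      have hmp : MeasurePreserving T (ν : Measure X) (ν : Measure X) := ⟨hT.measurable, hν⟩
      rw [variance_eq, int_bav ⟨T, hT⟩ (ν : Measure X) hmp fc hN]
      have h0 : 0 ≤ ∫ x, (g x - ∫ y, fc y ∂(ν : Measure X)) ^ 2 ∂(ν : Measure X) :=
        integral_nonneg fun x => sq_nonneg _
      have h1 : ε ≤ |(∫ y, fc y ∂(ν : Measure X)) - c| := by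
        have h' : ¬ (dist (∫ y, fc y ∂(ν : Measure X)) c < ε) := hn
        rw [Real.dist_eq] at h'
        exact not_lt.1 h'
      have h2 := pow_le_pow_left₀ hε.le h1 2
      rw [sq_abs] at h2
      linarith
  exact this

/-- Birkhoff sums. -/
def bsm (Tc : C(X, X)) (φ : C(X, ℝ)) : ℕ → C(X, ℝ)
  | 0 => 0
  | n + 1 => (bsm Tc φ n).comp Tc + φ

lemma int_bsm (Tc : C(X, X)) (ν : Measure X) [IsProbabilityMeasure ν]
    (h : MeasurePreserving Tc ν ν) (f : C(X, ℝ)) (n : ℕ) :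
    ∫ x, bsm Tc f n x ∂ν = n * ∫ x, f x ∂ν := by
  induction n with
  | zero => simp [bsm]
  | succ n ih =>
    simp only [bsm, ContinuousMap.add_apply]
    rw [integral_add (cint _ _) (cint _ _)]
    have := int_iter Tc ν h (bsm Tc f n) 1
    simp only [Function.iterate_one] at this
    rw [this, ih]; push_cast; ring

lemma coc_cont {d : ℕ} (T : X → X) (hT : Continuous T) (A : GLC X d) (n : ℕ) :
    Continuous (coc T A n) := by
  induction n with
  | zero => exact continuous_const
  | succ n ih =>
    have h : Continuous fun x => coc T A n (T x) * A.1.1 x :=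
      (ih.comp hT).mul A.1.1.continuous
    exact h

lemma coc_bound {d : ℕ} [NeZero d] (Tc : C(X, X)) (A : GLC X d) (φ : C(X, ℝ)) (δ : ℝ)
    (h1 : ∀ x, ‖A.1.1 x‖ ≤ Real.exp (φ x + δ)) (h2 : ∀ x, ‖A.1.2 x‖ ≤ Real.exp (-φ x + δ))
    (n : ℕ) (x : X) :
    Real.exp (bsm Tc φ n x - n * δ) ≤ ‖coc Tc A n x‖ ∧
      ‖coc Tc A n x‖ ≤ Real.exp (bsm Tc φ n x + n * δ) := by
  induction n generalizing x with
  | zero => simp [bsm, coc]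
  | succ n ih =>
    obtain ⟨l, u⟩ := ih (Tc x)
    constructor
    · have e : coc Tc A n (Tc x) = coc Tc A (n + 1) x * A.1.2 x := by
        simp only [coc]
        rw [mul_assoc, (A.2 x).1, mul_one]
      have : ‖coc Tc A n (Tc x)‖ ≤ ‖coc Tc A (n + 1) x‖ * Real.exp (-φ x + δ) := by
        rw [e]
        exact (norm_mul_le _ _).trans (mul_le_mul_of_nonneg_left (h2 x) (norm_nonneg _))
      have h3 := l.trans this
      rw [← div_le_iff₀ (Real.exp_pos _), ← Real.exp_sub] at h3
      refine le_trans (le_of_eq ?_) h3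
      congr 1
      simp [bsm]; ring
    · calc ‖coc Tc A (n + 1) x‖ ≤ ‖coc Tc A n (Tc x)‖ * ‖A.1.1 x‖ := norm_mul_le _ _
        _ ≤ Real.exp (bsm Tc φ n (Tc x) + n * δ) * Real.exp (φ x + δ) :=
          mul_le_mul u (h1 x) (norm_nonneg _) (Real.exp_pos _).le
        _ = _ := by
          rw [← Real.exp_add]; congr 1; simp [bsm]; ring

lemma lyap_bound {d : ℕ} [NeZero d] (T : X → X) (hT : Continuous T) (A : GLC X d) (φ : C(X, ℝ))
    (δ : ℝ)
    (h1 : ∀ x, ‖A.1.1 x‖ ≤ Real.exp (φ x + δ)) (h2 : ∀ x, ‖A.1.2 x‖ ≤ Real.exp (-φ x + δ))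
    (n : ℕ) : ∃ ψ : C(X, ℝ), (∀ x, ψ x = Real.log ‖coc T A n x‖) ∧
      ∀ x, |ψ x - bsm ⟨T, hT⟩ φ n x| ≤ n * δ := by
  have hb := coc_bound ⟨T, hT⟩ A φ δ h1 h2 n
  have hpos : ∀ x, 0 < ‖coc T A n x‖ := fun x => (Real.exp_pos _).trans_le (hb x).1
  refine ⟨⟨fun x => Real.log ‖coc T A n x‖,
    (coc_cont T hT A n).norm.log (fun x => (hpos x).ne')⟩, fun x => rfl, fun x => ?_⟩
  have l := (Real.le_log_iff_exp_le (hpos x)).2 (hb x).1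
  have u := (Real.log_le_iff_le_exp (hpos x)).2 (hb x).2
  simp only [ContinuousMap.coe_mk]
  rw [abs_le]
  constructor <;> linarith

lemma avg_bound {d : ℕ} [NeZero d] (T : X → X) (hT : Continuous T) (A : GLC X d) (φ : C(X, ℝ))
    (δ : ℝ)
    (h1 : ∀ x, ‖A.1.1 x‖ ≤ Real.exp (φ x + δ)) (h2 : ∀ x, ‖A.1.2 x‖ ≤ Real.exp (-φ x + δ))
    (n : ℕ) (hn : 1 ≤ n) (ν : ProbabilityMeasure X) (hν : ν ∈ invM T) :
    |lyapAvg T A ν n - ∫ x, φ x ∂(ν : Measure X)| ≤ δ := by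
  obtain ⟨ψ, e, b⟩ := lyap_bound T hT A φ δ h1 h2 n
  have hmp : MeasurePreserving T (ν : Measure X) (ν : Measure X) := ⟨hT.measurable, hν⟩
  have hi := int_bsm ⟨T, hT⟩ (ν : Measure X) hmp φ n
  have hn0 : (0 : ℝ) < n := by exact_mod_cast hn
  have hI : |(∫ x, ψ x ∂(ν : Measure X)) - n * ∫ x, φ x ∂(ν : Measure X)| ≤ n * δ := by
    rw [← hi, ← integral_sub (cint _ _) (cint _ _)]
    have := norm_integral_le_of_norm_le_const (μ := (ν : Measure X))
      (f := fun x => ψ x - bsm ⟨T, hT⟩ φ n x) (C := n * δ) (Eventually.of_forall b)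
    simpa using this
  unfold lyapAvg
  simp_rw [← e]
  have : (n : ℝ)⁻¹ * (∫ x, ψ x ∂(ν : Measure X)) - ∫ x, φ x ∂(ν : Measure X)
    = (n : ℝ)⁻¹ * ((∫ x, ψ x ∂(ν : Measure X)) - n * ∫ x, φ x ∂(ν : Measure X)) := by
    field_simp
  rw [this, abs_mul, abs_of_pos (inv_pos.2 hn0), inv_mul_le_iff₀ hn0]
  exact hI

lemma cont_int (ψ : C(X, ℝ)) :
    Continuous fun ν : ProbabilityMeasure X => ∫ x, ψ x ∂(ν : Measure X) := by
  rw [continuous_iff_continuousAt]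
  intro ν
  exact (ProbabilityMeasure.tendsto_iff_forall_integral_tendsto.1
    (tendsto_id (α := ProbabilityMeasure X))) (BoundedContinuousFunction.mkOfCompact ψ)

lemma exists_max {d : ℕ} [NeZero d] (T : X → X) (hT : Continuous T) (A : GLC X d) (φ : C(X, ℝ))
    (δ : ℝ)
    (h1 : ∀ x, ‖A.1.1 x‖ ≤ Real.exp (φ x + δ)) (h2 : ∀ x, ‖A.1.2 x‖ ≤ Real.exp (-φ x + δ))
    (Λ : Set (ProbabilityMeasure X))
    (hne : Λ.Nonempty) (hcomp : IsCompact Λ) (hinv : Λ ⊆ invM T) :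
    (∀ ν ∈ Λ, |lyapExp T A ν - ∫ x, φ x ∂(ν : Measure X)| ≤ δ) ∧
    ∃ ν ∈ MmaxL T Λ A, ∀ ν' ∈ Λ, lyapExp T A ν' ≤ lyapExp T A ν := by
  haveI : Nonempty {n : ℕ // 1 ≤ n} := ⟨⟨1, le_rfl⟩⟩
  have hb := avg_bound T hT A φ δ h1 h2
  have hbdd : ∀ ν ∈ Λ, BddBelow (range fun n : {n : ℕ // 1 ≤ n} => lyapAvg T A ν n) := by
    intro ν hν
    refine ⟨(∫ x, φ x ∂(ν : Measure X)) - δ, ?_⟩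
    rintro _ ⟨n, rfl⟩
    have := (abs_le.1 (hb n n.2 ν (hinv hν))).1
    simp only; linarith
  refine ⟨?_, ?_⟩
  · intro ν hν
    rw [abs_le]
    constructor
    · have : (∫ x, φ x ∂(ν : Measure X)) - δ ≤ lyapExp T A ν := le_ciInf fun n => by
        have := (abs_le.1 (hb n n.2 ν (hinv hν))).1
        linarith
      linarith
    · have : lyapExp T A ν ≤ lyapAvg T A ν 1 := ciInf_le (hbdd ν hν) ⟨1, le_rfl⟩
      have := (abs_le.1 (hb 1 le_rfl ν (hinv hν))).2
      linarith
  · have husc : UpperSemicontinuousOn (lyapExp T A) Λ := by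
      intro ν hν
      apply upperSemicontinuousWithinAt_ciInf
        (f := fun (n : {n : ℕ // 1 ≤ n}) ν => lyapAvg T A ν n)
      · filter_upwards [self_mem_nhdsWithin] with ν hν using hbdd ν hν
      · intro n
        obtain ⟨ψ, e, -⟩ := lyap_bound T hT A φ δ h1 h2 n
        have : Continuous fun ν => lyapAvg T A ν n := by
          unfold lyapAvg
          simp_rw [← e]
          exact continuous_const.mul (cont_int ψ)
        exact this.upperSemicontinuous.upperSemicontinuousWithinAt _ _
    obtain ⟨ν, hν, hm⟩ := husc.exists_isMaxOn hne hcomp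
    have hm' : ∀ ν' ∈ Λ, lyapExp T A ν' ≤ lyapExp T A ν := fun ν' h => hm h
    refine ⟨ν, ⟨hν, ?_⟩, hm'⟩
    haveI : Nonempty Λ := ⟨⟨ν, hν⟩⟩
    apply le_antisymm
    · exact le_ciSup (f := fun μ : Λ => lyapExp T A μ)
        ⟨lyapExp T A ν, by rintro _ ⟨μ, rfl⟩; exact hm' μ μ.2⟩ ⟨ν, hν⟩
    · exact ciSup_le fun μ => hm' μ μ.2

lemma exists_close {d : ℕ} [NeZero d] (φ : C(X, ℝ)) {δ : ℝ} (hδ : 0 < δ)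
    (F : Set (GLC X d)) (hF : Dense F) : ∃ A ∈ F, (∀ x, ‖A.1.1 x‖ ≤ Real.exp (φ x + δ)) ∧
      (∀ x, ‖A.1.2 x‖ ≤ Real.exp (-φ x + δ)) := by
  have hr : 0 < Real.exp (-‖φ‖) * (Real.exp δ - 1) :=
    mul_pos (Real.exp_pos _) (by linarith [Real.add_one_lt_exp hδ.ne'])
  obtain ⟨A, hA, hd⟩ := hF.exists_dist_lt (scale φ (idC X d)) hr
  set r := Real.exp (-‖φ‖) * (Real.exp δ - 1) with hrd
  have hd' : dist (scale φ (idC X d)).1 A.1 < r := hd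
  rw [Prod.dist_eq, max_lt_iff] at hd'
  have gen : ∀ (t : ℝ) (M : Md d), -‖φ‖ ≤ t → dist (Real.exp t • (1 : Md d)) M < r →
      ‖M‖ ≤ Real.exp (t + δ) := by
    intro t M ht hM
    rw [dist_eq_norm, norm_sub_rev] at hM
    have h1 : ‖M‖ ≤ ‖M - Real.exp t • (1 : Md d)‖ + ‖Real.exp t • (1 : Md d)‖ := by
      simpa using norm_add_le (M - Real.exp t • (1 : Md d)) (Real.exp t • (1 : Md d))
    have h2 : ‖Real.exp t • (1 : Md d)‖ = Real.exp t := by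
      rw [norm_smul]; simp
    have h3 : r ≤ Real.exp t * (Real.exp δ - 1) :=
      mul_le_mul_of_nonneg_right (Real.exp_le_exp.2 ht) (by linarith [Real.add_one_lt_exp hδ.ne'])
    rw [Real.exp_add]; linarith
  have hφ : ∀ x, |φ x| ≤ ‖φ‖ := fun x => φ.norm_coe_le_norm x
  refine ⟨A, hA, fun x => gen _ _ (abs_le.1 (hφ x)).1 ?_,
    fun x => gen _ _ (neg_le_neg (abs_le.1 (hφ x)).2) ?_⟩
  · exact (ContinuousMap.dist_apply_le_dist (f := (scale φ (idC X d)).1.1) x).trans_lt hd'.1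
  · exact (ContinuousMap.dist_apply_le_dist (f := (scale φ (idC X d)).1.2) x).trans_lt hd'.2

end helpers

/-- If the ergodic measures in `Λ` are dense in `Λ` and `F` is dense in
`C(X, GL_d(ℝ))`, then `⋃_{A∈F} M^Λ_max(A)` is dense in `Λ`. -/
theorem stmt14 {X : Type*} [MetricSpace X] [CompactSpace X] [MeasurableSpace X] [BorelSpace X]
    {d : ℕ} (T : X → X) (hT : Continuous T)
    (Λ : Set (MeasureTheory.ProbabilityMeasure X))
    (hne : Λ.Nonempty) (hcomp : IsCompact Λ) (hinv : Λ ⊆ invM T)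
    (herg : Λ ⊆ closure {μ ∈ Λ | Ergodic T (μ : MeasureTheory.Measure X)})
    (F : Set (GLC X d)) (hF : Dense F) :
    Λ ⊆ closure (⋃ A ∈ F, MmaxL T Λ A) := by
  rcases Nat.eq_zero_or_pos d with hd | hd
  · subst hd
    haveI : Nonempty (GLC X 0) := ⟨idC X 0⟩
    obtain ⟨A, hA⟩ := hF.nonempty
    have h0 : ∀ ν, lyapExp T A ν = 0 := by
      intro ν
      have h1 : ∀ n, lyapAvg T A ν n = 0 := by
        intro n
        have : ∀ x, ‖coc T A n x‖ = 0 := fun x => by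
          rw [norm_eq_zero]; exact Subsingleton.elim _ _
        simp [lyapAvg, this]
      simp [lyapExp, h1]
    intro ν hν
    apply subset_closure
    simp only [mem_iUnion]
    exact ⟨A, hA, hν, by simp [betaL, h0]⟩
  · haveI : NeZero d := ⟨hd.ne'⟩
    refine herg.trans (closure_minimal ?_ isClosed_closure)
    rintro μ ⟨hμ, hμe⟩
    rw [mem_closure_iff_nhds]
    intro U hU
    obtain ⟨φ, -, h2, h3⟩ := sep_le T hT μ hμe hU (1 / 4) (by norm_num)
    obtain ⟨A, hA, a1, a2⟩ := exists_close (d := d) φ (δ := 1 / 4) (by norm_num) F hF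
    obtain ⟨hb, ν, hν, hmax⟩ := exists_max T hT A φ (1 / 4) a1 a2 Λ hne hcomp hinv
    refine ⟨ν, ?_, mem_iUnion₂.2 ⟨A, hA, hν⟩⟩
    by_contra hn
    have b1 := h3 ν (hinv hν.1) hn
    have b2 := (abs_le.1 (hb ν hν.1)).2
    have b3 := (abs_le.1 (hb μ hμ)).1
    have b4 := hmax μ hμ
    linarith
end
end

section
/- Let X be a compact metric space and T : X → X continuous. If F is a dense subset of C(X, GL_d(ℝ)), then the set of ergodic measures that are Lyapunov-maximizing for some A ∈ F is dense in the space of ergodic T-invariant measures M^e(X,T). -/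
open MeasureTheory Topology Filter Set

noncomputable section

lemma aux_convexJoin_compact {E : Type*} [AddCommGroup E] [Module ℝ E] [TopologicalSpace E]
    [IsTopologicalAddGroup E] [ContinuousSMul ℝ E] {C D : Set E} (hC : IsCompact C)
    (hD : IsCompact D) : IsCompact (convexJoin ℝ C D) := by
  have : convexJoin ℝ C D =
      (fun z : (E × E) × ℝ => (1 - z.2) • z.1.1 + z.2 • z.1.2) '' ((C ×ˢ D) ×ˢ Icc (0:ℝ) 1) := by
    ext x
    simp only [mem_convexJoin, segment_eq_image, mem_image, mem_prod, Prod.exists]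
    constructor
    · rintro ⟨a, ha, b, hb, t, ht, rfl⟩
      exact ⟨a, b, t, ⟨⟨ha, hb⟩, ht⟩, rfl⟩
    · rintro ⟨a, b, t, ⟨⟨ha, hb⟩, ht⟩, rfl⟩
      exact ⟨a, ha, b, hb, t, ht, rfl⟩
  rw [this]
  exact ((hC.prod hD).prod isCompact_Icc).image (by fun_prop)

lemma aux_choquet {E : Type*} [AddCommGroup E] [Module ℝ E] [TopologicalSpace E]
    [IsTopologicalAddGroup E] [ContinuousSMul ℝ E] [LocallyConvexSpace ℝ E] [T2Space E]
    {K S : Set E} (hK : IsCompact K) (hKc : Convex ℝ K) {p : E} (hp : p ∈ K.extremePoints ℝ)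
    (hS : IsCompact S) (hSK : S ⊆ K) (hpS : p ∉ S) :
    ∃ (l : StrongDual ℝ E) (c : ℝ), c < l p ∧ ∀ q ∈ S, l q < c := by
  obtain ⟨C, hC, hCc, -, hpC, hSC⟩ : ∃ C : Set E, IsCompact C ∧ Convex ℝ C ∧ C ⊆ K ∧ p ∉ C ∧
      S ⊆ C := by
    refine hS.induction_on (p := fun s => ∃ C : Set E, IsCompact C ∧ Convex ℝ C ∧ C ⊆ K ∧ p ∉ C ∧
      s ⊆ C) ?_ ?_ ?_ ?_
    · exact ⟨∅, isCompact_empty, convex_empty, empty_subset _, by simp, subset_rfl⟩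
    · rintro s t hst ⟨C, h1, h2, h3, h4, h5⟩
      exact ⟨C, h1, h2, h3, h4, hst.trans h5⟩
    · rintro s t ⟨C, h1, h2, h3, h4, h5⟩ ⟨D, k1, k2, k3, k4, k5⟩
      rcases C.eq_empty_or_nonempty with rfl | hCn
      · exact ⟨D, k1, k2, k3, k4, union_subset (h5.trans (empty_subset _)) k5⟩
      rcases D.eq_empty_or_nonempty with rfl | hDn
      · exact ⟨C, h1, h2, h3, h4, union_subset h5 (k5.trans (empty_subset _))⟩
      refine ⟨convexJoin ℝ C D, aux_convexJoin_compact h1 k1, h2.convexJoin k2,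
        convexJoin_subset h3 k3 hKc, ?_, union_subset (h5.trans (subset_convexJoin_left hDn))
          (k5.trans (subset_convexJoin_right hCn))⟩
      rw [mem_convexJoin]
      rintro ⟨a, ha, b, hb, hab⟩
      rcases (mem_extremePoints_iff_forall_segment.1 hp).2 a (h3 ha) b (k3 hb) hab with h | h
      · exact h4 (h ▸ ha)
      · exact k4 (h ▸ hb)
    · intro q hq
      have hne : p ≠ q := fun h => hpS (h ▸ hq)
      obtain ⟨f, hf⟩ := geometric_hahn_banach_point_point hne
      obtain ⟨c, hc1, hc2⟩ := exists_between hf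
      refine ⟨S ∩ {x | c < f x}, ?_, K ∩ {x | c ≤ f x}, ?_, ?_, inter_subset_left, ?_, ?_⟩
      · exact inter_mem self_mem_nhdsWithin
          (mem_nhdsWithin_of_mem_nhds ((isOpen_lt continuous_const f.continuous).mem_nhds hc2))
      · exact hK.inter_right (isClosed_le continuous_const f.continuous)
      · exact hKc.inter (convex_halfSpace_ge f.toLinearMap.isLinear c)
      · rintro ⟨-, h⟩
        exact absurd h (not_le.2 hc1)
      · rintro x ⟨hx, hx'⟩
        exact ⟨hSK hx, le_of_lt (show c < f x from hx')⟩
  obtain ⟨f, u, hu1, hu2⟩ := geometric_hahn_banach_point_closed hCc hC.isClosed hpC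
  refine ⟨-f, -u, by simpa using hu1, fun q hq => ?_⟩
  simpa using hu2 q (hSC hq)

/-- Algebraic dual of `C(X,ℝ)` with the topology of pointwise convergence. -/
abbrev AuxE (X : Type*) [TopologicalSpace X] [CompactSpace X] :=
  WeakBilin (LinearMap.id : (C(X, ℝ) →ₗ[ℝ] ℝ) →ₗ[ℝ] (C(X, ℝ) →ₗ[ℝ] ℝ))

section
variable {X : Type*} [MetricSpace X] [CompactSpace X] [MeasurableSpace X] [BorelSpace X]

lemma aux_integrable (μ : Measure X) [IsFiniteMeasure μ] {f : X → ℝ} (hf : Continuous f) :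
    Integrable f μ :=
  hf.integrable_of_hasCompactSupport (HasCompactSupport.of_compactSpace f)

instance : T2Space (AuxE X) :=
  (WeakBilin.isEmbedding (B := (LinearMap.id : (C(X, ℝ) →ₗ[ℝ] ℝ) →ₗ[ℝ] (C(X, ℝ) →ₗ[ℝ] ℝ)))
    Function.injective_id).t2Space

def auxLin (μ : ProbabilityMeasure X) : C(X, ℝ) →ₗ[ℝ] ℝ where
  toFun f := ∫ x, f x ∂(μ : Measure X)
  map_add' f g := by
    simpa using integral_add (aux_integrable _ f.continuous) (aux_integrable _ g.continuous)
  map_smul' c f := by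
    simpa using integral_const_mul c (fun x => f x)

def auxPhi (μ : ProbabilityMeasure X) : AuxE X := auxLin μ

lemma auxPhi_continuous : Continuous (auxPhi : ProbabilityMeasure X → AuxE X) :=
  WeakBilin.continuous_of_continuous_eval _
    fun f => ProbabilityMeasure.continuous_integral_continuousMap f

lemma auxPhi_eq_iff {μ : ProbabilityMeasure X} {z : AuxE X} :
    auxPhi μ = z ↔ ∀ f : C(X, ℝ), ∫ x, f x ∂(μ : Measure X) =
      (show C(X, ℝ) →ₗ[ℝ] ℝ from z) f :=
  ⟨fun h f => by rw [← h]; rfl, fun h => LinearMap.ext h⟩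

lemma auxPhi_inj {μ ν : ProbabilityMeasure X} (h : auxPhi μ = auxPhi ν) : μ = ν := by
  apply ProbabilityMeasure.toMeasure_injective
  apply ext_of_forall_integral_eq_of_IsFiniteMeasure
  intro f
  exact auxPhi_eq_iff.1 h f.toContinuousMap

lemma aux_int_combo {a b : ℝ} (ha : 0 ≤ a) (hb : 0 ≤ b)
    {μ ν₁ ν₂ : ProbabilityMeasure X}
    (h : (μ : Measure X) = ENNReal.ofReal a • (ν₁ : Measure X) + ENNReal.ofReal b • (ν₂ : Measure X))
    {f : X → ℝ} (hf : Continuous f) :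
    ∫ x, f x ∂(μ : Measure X) = a * ∫ x, f x ∂(ν₁ : Measure X) + b * ∫ x, f x ∂(ν₂ : Measure X) := by
  rw [h, integral_add_measure, integral_smul_measure, integral_smul_measure,
    ENNReal.toReal_ofReal ha, ENNReal.toReal_ofReal hb]
  · rfl
  · exact (aux_integrable _ hf).smul_measure ENNReal.ofReal_ne_top
  · exact (aux_integrable _ hf).smul_measure ENNReal.ofReal_ne_top

lemma auxPhi_combo {a b : ℝ} (ha : 0 ≤ a) (hb : 0 ≤ b)
    {μ ν₁ ν₂ : ProbabilityMeasure X}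
    (h : (μ : Measure X) =
      ENNReal.ofReal a • (ν₁ : Measure X) + ENNReal.ofReal b • (ν₂ : Measure X)) :
    auxPhi μ = a • auxPhi ν₁ + b • auxPhi ν₂ :=
  auxPhi_eq_iff.2 fun f => aux_int_combo ha hb h f.continuous

lemma aux_exists_combo {T : X → X} (hT : Continuous T) {a b : ℝ} (ha : 0 ≤ a) (hb : 0 ≤ b)
    (hab : a + b = 1)
    {ν₁ ν₂ : ProbabilityMeasure X} (h₁ : ν₁ ∈ invM T) (h₂ : ν₂ ∈ invM T) :
    ∃ μ ∈ invM T, (μ : Measure X) =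
      ENNReal.ofReal a • (ν₁ : Measure X) + ENNReal.ofReal b • (ν₂ : Measure X) := by
  refine ⟨⟨ENNReal.ofReal a • (ν₁ : Measure X) + ENNReal.ofReal b • (ν₂ : Measure X), ⟨?_⟩⟩, ?_, rfl⟩
  · simp [← ENNReal.ofReal_add ha hb, hab]
  · change Measure.map T (ENNReal.ofReal a • (ν₁ : Measure X) + ENNReal.ofReal b • (ν₂ : Measure X))
      = ENNReal.ofReal a • (ν₁ : Measure X) + ENNReal.ofReal b • (ν₂ : Measure X)
    rw [Measure.map_add _ _ hT.measurable, Measure.map_smul, Measure.map_smul]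
    rw [show Measure.map T (ν₁ : Measure X) = ν₁ from h₁,
      show Measure.map T (ν₂ : Measure X) = ν₂ from h₂]

lemma aux_segment {T : X → X} (hT : Continuous T) {μ ν₁ ν₂ : ProbabilityMeasure X}
    (h₁ : ν₁ ∈ invM T) (h₂ : ν₂ ∈ invM T) {a b : ℝ} (ha : 0 ≤ a) (hb : 0 ≤ b)
    (hab : a + b = 1) (h : a • auxPhi ν₁ + b • auxPhi ν₂ = auxPhi μ) :
    (μ : Measure X) =
      ENNReal.ofReal a • (ν₁ : Measure X) + ENNReal.ofReal b • (ν₂ : Measure X) := by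
  obtain ⟨ν, -, hν⟩ := aux_exists_combo hT ha hb hab h₁ h₂
  rw [← hν, auxPhi_inj ((auxPhi_combo ha hb hν).trans h)]

lemma aux_mp {T : X → X} (hT : Continuous T) {μ : ProbabilityMeasure X} (h : μ ∈ invM T) :
    MeasurePreserving T (μ : Measure X) (μ : Measure X) := ⟨hT.measurable, h⟩

lemma aux_inv_closed {T : X → X} (hT : Continuous T) :
    IsClosed (invM T : Set (ProbabilityMeasure X)) := by
  have : (invM T : Set (ProbabilityMeasure X)) =
      {μ | μ.map hT.measurable.aemeasurable = μ} := by
    ext μ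
    refine ⟨fun h => ?_, fun h => ?_⟩
    · apply ProbabilityMeasure.toMeasure_injective
      rw [ProbabilityMeasure.toMeasure_map]
      exact h
    · change Measure.map T (μ : Measure X) = μ
      rw [← ProbabilityMeasure.toMeasure_map μ hT.measurable.aemeasurable]
      exact congrArg _ h
  rw [this]
  exact isClosed_eq (ProbabilityMeasure.continuous_map hT) continuous_id

lemma aux_erg_extreme {T : X → X} (hT : Continuous T) {μ : ProbabilityMeasure X}
    (h : Ergodic T (μ : Measure X)) : auxPhi μ ∈ (auxPhi '' invM T).extremePoints ℝ := by
  rw [mem_extremePoints_iff_left]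
  refine ⟨⟨μ, h.map_eq, rfl⟩, ?_⟩
  rintro _ ⟨ν₁, h₁, rfl⟩ _ ⟨ν₂, h₂, rfl⟩ ⟨a, b, ha, hb, hab, hs⟩
  have := aux_segment hT h₁ h₂ ha.le hb.le hab hs
  have h3 := (mem_extremePoints_iff_left.1 h.mem_extremePoints).2 ν₁
    ⟨aux_mp hT h₁, inferInstance⟩ ν₂ ⟨aux_mp hT h₂, inferInstance⟩
    ⟨ENNReal.ofReal a, ENNReal.ofReal b, by simpa, by simpa,
      by rw [← ENNReal.ofReal_add ha.le hb.le, hab, ENNReal.ofReal_one], this.symm⟩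
  rw [ProbabilityMeasure.toMeasure_injective h3]

lemma aux_extreme_erg {T : X → X} (hT : Continuous T) {μ : ProbabilityMeasure X}
    (hμ : μ ∈ invM T)
    (h : auxPhi μ ∈ (auxPhi '' invM T).extremePoints ℝ) : Ergodic T (μ : Measure X) := by
  apply Ergodic.of_mem_extremePoints
  rw [mem_extremePoints_iff_left]
  refine ⟨⟨aux_mp hT hμ, inferInstance⟩, ?_⟩
  rintro ν₁ ⟨h₁, i₁⟩ ν₂ ⟨h₂, i₂⟩ ⟨a, b, ha, hb, hab, hs⟩
  have ha' : a ≠ ⊤ := by rintro rfl; simp at hab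
  have hb' : b ≠ ⊤ := by rintro rfl; simp at hab
  have key := (mem_extremePoints_iff_left.1 h).2 (auxPhi ⟨ν₁, i₁⟩) ⟨⟨ν₁, i₁⟩, h₁.map_eq, rfl⟩
    (auxPhi ⟨ν₂, i₂⟩) ⟨⟨ν₂, i₂⟩, h₂.map_eq, rfl⟩ ⟨a.toReal, b.toReal,
      ENNReal.toReal_pos ha.ne' ha', ENNReal.toReal_pos hb.ne' hb', by
        rw [← ENNReal.toReal_add ha' hb', hab, ENNReal.toReal_one], ?_⟩
  · exact congrArg (fun m : ProbabilityMeasure X => (m : Measure X)) (auxPhi_inj key)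
  · refine (auxPhi_combo ENNReal.toReal_nonneg ENNReal.toReal_nonneg ?_).symm
    rw [ENNReal.ofReal_toReal ha', ENNReal.ofReal_toReal hb']
    exact hs.symm

lemma aux_K_convex {T : X → X} (hT : Continuous T) :
    Convex ℝ (auxPhi '' (invM T : Set (ProbabilityMeasure X))) := by
  rintro _ ⟨ν₁, h₁, rfl⟩ _ ⟨ν₂, h₂, rfl⟩ a b ha hb hab
  obtain ⟨ν, hν, h⟩ := aux_exists_combo hT ha hb hab h₁ h₂
  exact ⟨ν, hν, auxPhi_combo ha hb h⟩

lemma aux_dual (l : StrongDual ℝ (AuxE X)) :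
    ∃ f : C(X, ℝ), ∀ ν : ProbabilityMeasure X, l (auxPhi ν) = ∫ x, f x ∂(ν : Measure X) := by
  obtain ⟨f, rfl⟩ := LinearMap.dualEmbedding_surjective
    (LinearMap.id : (C(X, ℝ) →ₗ[ℝ] ℝ) →ₗ[ℝ] (C(X, ℝ) →ₗ[ℝ] ℝ)) l
  exact ⟨f, fun ν => rfl⟩

/-- Slices at ergodic measures. -/
lemma aux_slice {T : X → X} (hT : Continuous T) {μ : ProbabilityMeasure X}
    (h : Ergodic T (μ : Measure X)) {U : Set (ProbabilityMeasure X)} (hU : IsOpen U)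
    (hμU : μ ∈ U) : ∃ (f : C(X, ℝ)) (c : ℝ), c < ∫ x, f x ∂(μ : Measure X) ∧
      ∀ ν ∈ invM T, c ≤ ∫ x, f x ∂(ν : Measure X) → ν ∈ U := by
  have hM : IsCompact (invM T : Set (ProbabilityMeasure X)) := (aux_inv_closed hT).isCompact
  have hS : IsCompact (auxPhi '' (invM T \ U)) := (hM.diff hU).image auxPhi_continuous
  have hK : IsCompact (auxPhi '' (invM T : Set (ProbabilityMeasure X))) :=
    hM.image auxPhi_continuous
  have hpS : auxPhi μ ∉ auxPhi '' (invM T \ U) := by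
    rintro ⟨ν, hν, h⟩
    have h' := auxPhi_inj h
    subst h'
    exact hν.2 hμU
  have hSK : auxPhi '' (invM T \ U) ⊆ auxPhi '' (invM T : Set (ProbabilityMeasure X)) :=
    image_mono diff_subset
  have key := aux_choquet hK (aux_K_convex hT) (aux_erg_extreme hT h) hS hSK hpS
  obtain ⟨l, c, h1, h2⟩ := key
  obtain ⟨f, hf⟩ := aux_dual l
  rw [hf μ] at h1
  refine ⟨f, c, h1, fun ν hν hc => ?_⟩
  by_contra hn
  have h3 := h2 (auxPhi ν) (mem_image_of_mem _ ⟨hν, hn⟩)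
  rw [hf ν] at h3
  exact absurd h3 (not_lt.2 hc)

lemma aux_coc_cont {d : ℕ} {T : X → X} (hT : Continuous T) (A : GLC X d) (n : ℕ) :
    Continuous (coc T A n) := by
  induction n with
  | zero => exact continuous_const
  | succ n ih => exact (ih.comp hT).mul A.1.1.continuous

lemma aux_coc_add {d : ℕ} (T : X → X) (A : GLC X d) (m n : ℕ) (x : X) :
    coc T A (m + n) x = coc T A m (T^[n] x) * coc T A n x := by
  induction n generalizing x with
  | zero => exact (mul_one _).symm
  | succ n ih =>
    change coc T A (m + n) (T x) * A.1.1 x = coc T A m (T^[n] (T x)) * (coc T A n (T x) * A.1.1 x)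
    rw [ih, mul_assoc]

lemma aux_norm_le {d : ℕ} [NeZero d] {T : X → X} {A : GLC X d} {f : C(X, ℝ)} {ε : ℝ}
    (h1 : ∀ x, ‖A.1.1 x‖ ≤ Real.exp (f x + ε)) (n : ℕ) (x : X) :
    ‖coc T A n x‖ ≤ Real.exp (birkhoffSum T f n x + n * ε) := by
  induction n generalizing x with
  | zero => simp [coc, ContinuousLinearMap.norm_id]
  | succ n ih =>
    calc ‖coc T A n (T x) * A.1.1 x‖ ≤ ‖coc T A n (T x)‖ * ‖A.1.1 x‖ := norm_mul_le _ _
      _ ≤ Real.exp (birkhoffSum T f n (T x) + n * ε) * Real.exp (f x + ε) :=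
        mul_le_mul (ih _) (h1 x) (norm_nonneg _) (Real.exp_pos _).le
      _ = _ := by
        rw [← Real.exp_add, birkhoffSum_succ']
        push_cast
        ring_nf

lemma aux_le_norm {d : ℕ} [NeZero d] {T : X → X} {A : GLC X d} {f : C(X, ℝ)} {ε : ℝ}
    (h2 : ∀ x, ‖A.1.2 x‖ ≤ Real.exp (-f x + ε)) (n : ℕ) (x : X) :
    Real.exp (birkhoffSum T f n x - n * ε) ≤ ‖coc T A n x‖ := by
  induction n generalizing x with
  | zero => simp [coc]
  | succ n ih =>
    have e : coc T A n (T x) = coc T A (n + 1) x * A.1.2 x := by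
      change _ = coc T A n (T x) * A.1.1 x * A.1.2 x
      rw [mul_assoc, (A.2 x).1, mul_one]
    have := calc Real.exp (birkhoffSum T f n (T x) - n * ε) ≤ ‖coc T A n (T x)‖ := ih _
      _ ≤ ‖coc T A (n + 1) x‖ * ‖A.1.2 x‖ := by rw [e]; exact norm_mul_le _ _
      _ ≤ ‖coc T A (n + 1) x‖ * Real.exp (-f x + ε) := by gcongr; exact h2 x
    have e2 : Real.exp (birkhoffSum T f (n + 1) x - (n + 1 : ℕ) * ε) =
        Real.exp (birkhoffSum T f n (T x) - n * ε) / Real.exp (-f x + ε) := by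
      rw [← Real.exp_sub, birkhoffSum_succ']
      push_cast
      ring_nf
    rw [e2, div_le_iff₀ (Real.exp_pos _)]
    exact this

lemma aux_birk {T : X → X} (hT : Continuous T) (f : C(X, ℝ)) {ν : ProbabilityMeasure X}
    (hν : ν ∈ invM T) (n : ℕ) :
    ∫ x, birkhoffSum T f n x ∂(ν : Measure X) = n * ∫ x, f x ∂(ν : Measure X) := by
  simp only [birkhoffSum]
  rw [integral_finsetSum (f := fun i x => f (T^[i] x)) _ (fun i _ => aux_integrable _ (f.continuous.comp (hT.iterate i)))]
  have : ∀ i, ∫ x, f (T^[i] x) ∂(ν : Measure X) = ∫ x, f x ∂(ν : Measure X) := fun i => by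
    have hm := (aux_mp hT hν).iterate i
    conv_rhs => rw [← hm.map_eq]
    exact (integral_map hm.measurable.aemeasurable
      f.continuous.aestronglyMeasurable).symm
  simp [this]

structure AuxNear {d : ℕ} (A : GLC X d) (f : C(X, ℝ)) (ε : ℝ) : Prop where
  up : ∀ x, ‖A.1.1 x‖ ≤ Real.exp (f x + ε)
  lo : ∀ x, ‖A.1.2 x‖ ≤ Real.exp (-f x + ε)

lemma AuxNear.pos {d : ℕ} [NeZero d] {A : GLC X d} {f : C(X, ℝ)} {ε : ℝ} (h : AuxNear A f ε)
    (T : X → X) (n : ℕ) (x : X) : 0 < ‖coc T A n x‖ :=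
  (Real.exp_pos _).trans_le (aux_le_norm h.lo n x)

lemma AuxNear.cont {d : ℕ} [NeZero d] {A : GLC X d} {f : C(X, ℝ)} {ε : ℝ} (h : AuxNear A f ε)
    {T : X → X} (hT : Continuous T) (n : ℕ) : Continuous fun x => Real.log ‖coc T A n x‖ :=
  (aux_coc_cont hT A n).norm.log fun x => (h.pos T n x).ne'

lemma aux_birk_cont {T : X → X} (hT : Continuous T) (f : C(X, ℝ)) (n : ℕ) :
    Continuous (birkhoffSum T f n) := by
  unfold birkhoffSum
  exact continuous_finsetSum _ fun i _ => f.continuous.comp (hT.iterate i)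

lemma AuxNear.int_le {d : ℕ} [NeZero d] {A : GLC X d} {f : C(X, ℝ)} {ε : ℝ} (h : AuxNear A f ε)
    {T : X → X} (hT : Continuous T) {ν : ProbabilityMeasure X} (hν : ν ∈ invM T) (n : ℕ) :
    ∫ x, Real.log ‖coc T A n x‖ ∂(ν : Measure X) ≤ n * (∫ x, f x ∂(ν : Measure X) + ε) := by
  calc _ ≤ ∫ x, (birkhoffSum T f n x + n * ε) ∂(ν : Measure X) := by
        refine integral_mono (aux_integrable _ (h.cont hT n))
          (aux_integrable _ ((aux_birk_cont hT f n).add continuous_const)) fun x => ?_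
        exact (Real.log_le_iff_le_exp (h.pos T n x)).2 (aux_norm_le h.up n x)
    _ = _ := by
      rw [integral_add (aux_integrable _ (aux_birk_cont hT f n))
        (aux_integrable _ continuous_const), aux_birk hT f hν]
      simp
      ring

lemma AuxNear.le_int {d : ℕ} [NeZero d] {A : GLC X d} {f : C(X, ℝ)} {ε : ℝ} (h : AuxNear A f ε)
    {T : X → X} (hT : Continuous T) {ν : ProbabilityMeasure X} (hν : ν ∈ invM T) (n : ℕ) :
    n * (∫ x, f x ∂(ν : Measure X) - ε) ≤ ∫ x, Real.log ‖coc T A n x‖ ∂(ν : Measure X) := by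
  calc _ = ∫ x, (birkhoffSum T f n x - n * ε) ∂(ν : Measure X) := by
        rw [integral_sub (aux_integrable _ (aux_birk_cont hT f n))
          (aux_integrable _ continuous_const), aux_birk hT f hν]
        simp
        ring
    _ ≤ _ := by
        refine integral_mono (aux_integrable _ ((aux_birk_cont hT f n).sub continuous_const))
          (aux_integrable _ (h.cont hT n)) fun x => ?_
        exact (Real.le_log_iff_exp_le (h.pos T n x)).2 (aux_le_norm h.lo n x)

lemma AuxNear.avg_le {d : ℕ} [NeZero d] {A : GLC X d} {f : C(X, ℝ)} {ε : ℝ} (h : AuxNear A f ε)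
    {T : X → X} (hT : Continuous T) {ν : ProbabilityMeasure X} (hν : ν ∈ invM T) {n : ℕ}
    (hn : 1 ≤ n) : lyapAvg T A ν n ≤ ∫ x, f x ∂(ν : Measure X) + ε := by
  have hn' : (0 : ℝ) < n := by exact_mod_cast hn
  rw [lyapAvg, inv_mul_le_iff₀ hn']
  exact h.int_le hT hν n

lemma AuxNear.le_avg {d : ℕ} [NeZero d] {A : GLC X d} {f : C(X, ℝ)} {ε : ℝ} (h : AuxNear A f ε)
    {T : X → X} (hT : Continuous T) {ν : ProbabilityMeasure X} (hν : ν ∈ invM T) {n : ℕ}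
    (hn : 1 ≤ n) : ∫ x, f x ∂(ν : Measure X) - ε ≤ lyapAvg T A ν n := by
  have hn' : (0 : ℝ) < n := by exact_mod_cast hn
  rw [lyapAvg, le_inv_mul_iff₀ hn']
  exact h.le_int hT hν n

lemma AuxNear.bdd {d : ℕ} [NeZero d] {A : GLC X d} {f : C(X, ℝ)} {ε : ℝ} (h : AuxNear A f ε)
    {T : X → X} (hT : Continuous T) {ν : ProbabilityMeasure X} (hν : ν ∈ invM T) :
    BddBelow (range fun n : {n : ℕ // 1 ≤ n} => lyapAvg T A ν n) :=
  ⟨∫ x, f x ∂(ν : Measure X) - ε, by rintro _ ⟨n, rfl⟩; exact h.le_avg hT hν n.2⟩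

lemma AuxNear.exp_le {d : ℕ} [NeZero d] {A : GLC X d} {f : C(X, ℝ)} {ε : ℝ} (h : AuxNear A f ε)
    {T : X → X} (hT : Continuous T) {ν : ProbabilityMeasure X} (hν : ν ∈ invM T) :
    lyapExp T A ν ≤ ∫ x, f x ∂(ν : Measure X) + ε :=
  (ciInf_le (h.bdd hT hν) ⟨1, le_rfl⟩).trans (h.avg_le hT hν le_rfl)

lemma AuxNear.le_exp {d : ℕ} [NeZero d] {A : GLC X d} {f : C(X, ℝ)} {ε : ℝ} (h : AuxNear A f ε)
    {T : X → X} (hT : Continuous T) {ν : ProbabilityMeasure X} (hν : ν ∈ invM T) :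
    ∫ x, f x ∂(ν : Measure X) - ε ≤ lyapExp T A ν := by
  haveI : Nonempty {n : ℕ // 1 ≤ n} := ⟨⟨1, le_rfl⟩⟩
  exact le_ciInf fun n => h.le_avg hT hν n.2

lemma AuxNear.tendsto {d : ℕ} [NeZero d] {A : GLC X d} {f : C(X, ℝ)} {ε : ℝ} (h : AuxNear A f ε)
    {T : X → X} (hT : Continuous T) {ν : ProbabilityMeasure X} (hν : ν ∈ invM T) :
    Tendsto (fun n => lyapAvg T A ν n) atTop (𝓝 (lyapExp T A ν)) := by
  have hsub : Subadditive fun n => ∫ x, Real.log ‖coc T A n x‖ ∂(ν : Measure X) := by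
    intro m n
    have hm := (aux_mp hT hν).iterate n
    have e : ∫ x, Real.log ‖coc T A m x‖ ∂(ν : Measure X) =
        ∫ x, Real.log ‖coc T A m (T^[n] x)‖ ∂(ν : Measure X) := by
      conv_lhs => rw [← hm.map_eq]
      exact integral_map hm.measurable.aemeasurable (h.cont hT m).aestronglyMeasurable
    have c1 : Continuous fun x => Real.log ‖coc T A m (T^[n] x)‖ :=
      (h.cont hT m).comp (hT.iterate n)
    beta_reduce
    rw [e, ← integral_add (aux_integrable _ c1) (aux_integrable _ (h.cont hT n))]
    refine integral_mono (aux_integrable _ (h.cont hT _))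
      (aux_integrable _ (c1.add (h.cont hT n))) fun x => ?_
    beta_reduce
    rw [← Real.log_mul (h.pos T _ _).ne' (h.pos T _ _).ne']
    apply Real.log_le_log (h.pos T _ _)
    rw [aux_coc_add]
    exact norm_mul_le _ _
  have heq : ∀ n : ℕ, (∫ x, Real.log ‖coc T A n x‖ ∂(ν : Measure X)) / n = lyapAvg T A ν n :=
    fun n => by rw [lyapAvg, div_eq_inv_mul]
  have hlim : hsub.lim = lyapExp T A ν := by
    rw [Subadditive.lim, lyapExp, iInf]
    congr 1
    ext y
    simp only [heq, mem_image, mem_range, Subtype.exists, mem_Ici, exists_prop]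
  have hb : BddBelow (range fun n : ℕ => (∫ x, Real.log ‖coc T A n x‖ ∂(ν : Measure X)) / n) := by
    refine ⟨min 0 (∫ x, f x ∂(ν : Measure X) - ε), ?_⟩
    rintro _ ⟨n, rfl⟩
    rcases Nat.eq_zero_or_pos n with rfl | hn
    · simp
    · beta_reduce
      rw [heq]
      exact (min_le_right _ _).trans (h.le_avg hT hν hn)
  have := hsub.tendsto_lim hb
  rw [hlim] at this
  exact this.congr heq

lemma AuxNear.affine {d : ℕ} [NeZero d] {A : GLC X d} {f : C(X, ℝ)} {ε : ℝ} (h : AuxNear A f ε)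
    {T : X → X} (hT : Continuous T) {ν ν₁ ν₂ : ProbabilityMeasure X} (hν : ν ∈ invM T)
    (h₁ : ν₁ ∈ invM T) (h₂ : ν₂ ∈ invM T) {a b : ℝ} (ha : 0 ≤ a) (hb : 0 ≤ b)
    (hc : (ν : Measure X) =
      ENNReal.ofReal a • (ν₁ : Measure X) + ENNReal.ofReal b • (ν₂ : Measure X)) :
    lyapExp T A ν = a * lyapExp T A ν₁ + b * lyapExp T A ν₂ := by
  refine tendsto_nhds_unique (h.tendsto hT hν)
    ((((h.tendsto hT h₁).const_mul a).add ((h.tendsto hT h₂).const_mul b)).congr fun n => ?_)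
  simp only [lyapAvg]
  rw [aux_int_combo ha hb hc (h.cont hT n)]
  ring

lemma AuxNear.exists_erg {d : ℕ} [NeZero d] {A : GLC X d} {f : C(X, ℝ)} {ε : ℝ}
    (h : AuxNear A f ε) {T : X → X} (hT : Continuous T)
    (hne : (invM T : Set (ProbabilityMeasure X)).Nonempty) :
    ∃ ν : ProbabilityMeasure X, Ergodic T (ν : Measure X) ∧ ν ∈ MmaxL T (invM T) A ∧
      ∀ μ ∈ invM T, lyapExp T A μ ≤ lyapExp T A ν := by
  have hM : IsCompact (invM T : Set (ProbabilityMeasure X)) := (aux_inv_closed hT).isCompact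
  have hcont : ∀ n, Continuous fun ν : ProbabilityMeasure X => lyapAvg T A ν n := fun n =>
    continuous_const.mul (ProbabilityMeasure.continuous_integral_continuousMap
      (⟨_, h.cont hT n⟩ : C(X, ℝ)))
  haveI : Nonempty {n : ℕ // 1 ≤ n} := ⟨⟨1, le_rfl⟩⟩
  have husc : UpperSemicontinuousOn (fun ν : ProbabilityMeasure X => lyapExp T A ν) (invM T) := by
    intro ν hν y hy
    obtain ⟨n, hn⟩ := exists_lt_of_ciInf_lt hy
    filter_upwards [self_mem_nhdsWithin, mem_nhdsWithin_of_mem_nhds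
      ((isOpen_lt (hcont n) continuous_const).mem_nhds hn)] with μ hμ hμ'
    exact (ciInf_le (h.bdd hT hμ) n).trans_lt hμ'
  obtain ⟨ν₀, hν₀, hmax⟩ := husc.exists_isMaxOn hne hM
  set β := lyapExp T A ν₀ with hβ
  have hmax' : ∀ μ ∈ invM T, lyapExp T A μ ≤ β := fun μ hμ => hmax hμ
  have hbeta : betaL T (invM T) A = β := by
    haveI : Nonempty (invM T : Set (ProbabilityMeasure X)) := ⟨⟨ν₀, hν₀⟩⟩
    apply le_antisymm
    · exact ciSup_le fun μ => hmax' μ μ.2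
    · exact le_ciSup (f := fun μ : (invM T : Set (ProbabilityMeasure X)) => lyapExp T A μ)
        ⟨β, by rintro _ ⟨μ, rfl⟩; exact hmax' μ μ.2⟩ ⟨ν₀, hν₀⟩
  let N : Set (ProbabilityMeasure X) := {μ | μ ∈ invM T ∧ lyapExp T A μ = β}
  have hN : IsCompact N := by
    have : N = invM T ∩ ⋂ n : {n : ℕ // 1 ≤ n}, {μ | β ≤ lyapAvg T A μ n} := by
      ext μ
      simp only [N, mem_setOf_eq, mem_inter_iff, mem_iInter]
      refine and_congr_right fun hμ => ⟨fun e n => ?_, fun e => ?_⟩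
      · rw [← e]; exact ciInf_le (h.bdd hT hμ) n
      · exact le_antisymm (hmax' μ hμ) (le_ciInf e)
    rw [this]
    exact hM.inter_right (isClosed_iInter fun n => isClosed_le continuous_const (hcont n))
  obtain ⟨z, hz⟩ := (hN.image auxPhi_continuous).extremePoints_nonempty
    ⟨_, ν₀, ⟨hν₀, rfl⟩, rfl⟩
  have hext : IsExtreme ℝ (auxPhi '' invM T) (auxPhi '' N) := by
    rw [isExtreme_iff]
    refine ⟨image_mono fun μ hμ => hμ.1, ?_⟩
    rintro _ ⟨ν₁, h₁, rfl⟩ _ ⟨ν₂, h₂, rfl⟩ _ ⟨ν, hν, rfl⟩ ⟨a, b, ha, hb, hab, hs⟩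
    have haff := h.affine hT hν.1 h₁ h₂ ha.le hb.le (aux_segment hT h₁ h₂ ha.le hb.le hab hs)
    rw [hν.2] at haff
    refine ⟨ν₁, ⟨h₁, le_antisymm (hmax' _ h₁) ?_⟩, rfl⟩
    have k2 := mul_le_mul_of_nonneg_left (hmax' _ h₂) hb.le
    have : a * β ≤ a * lyapExp T A ν₁ := by
      have : β = a * β + b * β := by rw [← add_mul, hab, one_mul]
      linarith
    exact le_of_mul_le_mul_left this ha
  obtain ⟨ν, hν, rfl⟩ := hz.1
  refine ⟨ν, aux_extreme_erg hT hν.1 (hext.extremePoints_subset_extremePoints hz),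
    ⟨hν.1, hν.2.trans hbeta.symm⟩, fun μ hμ => ?_⟩
  rw [hν.2]
  exact hmax' μ hμ

lemma aux_exists_near {d : ℕ} {F : Set (GLC X d)} (hF : Dense F) (f : C(X, ℝ)) {ε : ℝ}
    (hε : 0 < ε) : ∃ A ∈ F, AuxNear A f ε := by
  have hη : 0 < (Real.exp ε - 1) * Real.exp (-‖f‖) :=
    mul_pos (by linarith [Real.add_one_lt_exp hε.ne']) (Real.exp_pos _)
  obtain ⟨A, hA, hAF⟩ := hF.exists_dist_lt (scale f (idC X d)) hη
  have hd : dist (scale f (idC X d)).1 A.1 < (Real.exp ε - 1) * Real.exp (-‖f‖) := hAF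
  rw [Prod.dist_eq, max_lt_iff] at hd
  have hone : ‖(1 : Md d)‖ ≤ 1 := ContinuousLinearMap.norm_id_le
  have gen : ∀ (g : ℝ) (P Q : Md d), ‖g‖ ≤ ‖f‖ → P = Real.exp g • (1 : Md d) →
      dist P Q ≤ (Real.exp ε - 1) * Real.exp (-‖f‖) → ‖Q‖ ≤ Real.exp (g + ε) := by
    intro g P Q hg hP hPQ
    have h1 : ‖Q‖ ≤ ‖P‖ + dist P Q := by
      rw [dist_comm, dist_eq_norm]
      linarith [norm_le_norm_add_norm_sub' Q P]
    have h2 : ‖P‖ ≤ Real.exp g := by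
      rw [hP, norm_smul, Real.norm_eq_abs, abs_of_pos (Real.exp_pos _)]
      exact mul_le_of_le_one_right (Real.exp_pos _).le hone
    have h3 : Real.exp (-‖f‖) ≤ Real.exp g :=
      Real.exp_le_exp.2 (by linarith [neg_le_of_abs_le hg])
    have h4 := mul_le_mul_of_nonneg_left h3
      (by linarith [Real.add_one_lt_exp hε.ne'] : 0 ≤ Real.exp ε - 1)
    rw [Real.exp_add]
    linarith
  refine ⟨A, hA, fun x => ?_, fun x => ?_⟩
  · exact gen (f x) ((scale f (idC X d)).1.1 x) _ (f.norm_coe_le_norm x) rfl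
      ((ContinuousMap.dist_apply_le_dist x).trans hd.1.le)
  · exact gen (-f x) ((scale f (idC X d)).1.2 x) _ (by rw [norm_neg]; exact f.norm_coe_le_norm x) rfl
      ((ContinuousMap.dist_apply_le_dist x).trans hd.2.le)

end

/-- If `F` is dense in `C(X, GL_d(ℝ))`, then the ergodic measures that are
Lyapunov-maximizing (over `M(X,T)`) for some `A ∈ F` are dense in the ergodic
measures. -/
theorem stmt15 {X : Type*} [MetricSpace X] [CompactSpace X] [MeasurableSpace X] [BorelSpace X]
    {d : ℕ} (T : X → X) (hT : Continuous T)
    (F : Set (GLC X d)) (hF : Dense F) :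
    {μ : MeasureTheory.ProbabilityMeasure X | Ergodic T (μ : MeasureTheory.Measure X)}
      ⊆ closure {μ : MeasureTheory.ProbabilityMeasure X |
          Ergodic T (μ : MeasureTheory.Measure X) ∧
            ∃ A ∈ F, μ ∈ MmaxL T (invM T) A} := by
  intro μ hμ
  have hμe : Ergodic T (μ : Measure X) := hμ
  have hμi : μ ∈ invM T := hμe.map_eq
  rcases Nat.eq_zero_or_pos d with rfl | hd
  · haveI : Nonempty (GLC X 0) := ⟨idC X 0⟩
    obtain ⟨A, hA⟩ := hF.nonempty
    apply subset_closure
    have hz : ∀ ν : ProbabilityMeasure X, lyapExp T A ν = 0 := by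
      intro ν
      have : ∀ n x, ‖coc T A n x‖ = 0 := fun n x => by
        rw [Subsingleton.elim (coc T A n x) 0, norm_zero]
      haveI : Nonempty {n : ℕ // 1 ≤ n} := ⟨⟨1, le_rfl⟩⟩
      simp [lyapExp, lyapAvg, this]
    haveI : Nonempty (invM T : Set (ProbabilityMeasure X)) := ⟨⟨μ, hμi⟩⟩
    exact ⟨hμe, A, hA, hμi, by simp [betaL, hz]⟩
  haveI : NeZero d := ⟨hd.ne'⟩
  rw [mem_closure_iff]
  intro U hU hμU
  obtain ⟨f, c, hc, hs⟩ := aux_slice hT hμe hU hμU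
  obtain ⟨A, hA, hn⟩ := aux_exists_near hF f (half_pos (sub_pos.2 hc))
  obtain ⟨ν, hν, hνm, hmax⟩ := hn.exists_erg hT ⟨μ, hμi⟩
  refine ⟨ν, hs ν hνm.1 ?_, hν, A, hA, hνm⟩
  have k1 := hn.le_exp hT hμi
  have k2 := hn.exp_le hT hνm.1
  have k3 := hmax μ hμi
  linarith
end
end
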